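/- For every trans r-matrix A with ℓ rows and length k ≤ n, the polynomial G_A lies in the ideal J generated by the monomial quasi-invariants. Consequently, for every trans r-matrix A of length at most n there is an element of J whose lexicographically greatest monomial is X^A = ∏_{c=1}^k X_c^{A_c}. -/

import Mathlib

open scoped Classical

noncomputable section

/-- The polynomial ring `ℚ[x_{ij} : 1 ≤ i ≤ ℓ, 1 ≤ j ≤ n]`. -/
abbrev PolyR (ℓ n : ℕ) : Type := MvPolynomial (Fin ℓ × Fin n) ℚ

/-- The monomial quasi-invariant `M_A` attached to a matrix `A` given as a list of columns
(each column a function `Fin ℓ → ℕ`): the sum over all strictly increasing choices of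
columns of variables of the corresponding product of powers. -/
noncomputable def Mlist (n : ℕ) {ℓ : ℕ} (A : List (Fin ℓ → ℕ)) : PolyR ℓ n :=
  ∑ s ∈ Finset.univ.filter (fun s : Fin A.length → Fin n => StrictMono s),
    ∏ c : Fin A.length, ∏ i : Fin ℓ, MvPolynomial.X (i, s c) ^ (A.get c i)

/-- `A` (a list of columns) is an `r`-composition-matrix: it is nonempty and each column sum
is a positive multiple of `r`. -/
def IsRCompList (r : ℕ) {ℓ : ℕ} (A : List (Fin ℓ → ℕ)) : Prop :=
  A ≠ [] ∧ ∀ V ∈ A, (∑ i, V i) ≠ 0 ∧ r ∣ (∑ i, V i)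

/-- `A` (a list of columns) is an `r`-matrix: all column sums are divisible by `r` and the
last column (if any) is nonzero. -/
def IsRMatrixList (r : ℕ) {ℓ : ℕ} (A : List (Fin ℓ → ℕ)) : Prop :=
  (∀ V ∈ A, r ∣ (∑ i, V i)) ∧ ∀ h : A ≠ [], A.getLast h ≠ 0

/-- An `r`-matrix `A = A₁⋯A_k` is *trans* if `w_r(A₁⋯A_j) ≥ j` for some `1 ≤ j ≤ k`,
i.e. the sum of the entries of the first `j` columns is at least `r * j`. -/
def IsTransMat (r : ℕ) {ℓ : ℕ} (A : List (Fin ℓ → ℕ)) : Prop :=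
  ∃ j : ℕ, 1 ≤ j ∧ j ≤ A.length ∧ r * j ≤ (((A.take j).map fun V => ∑ i, V i).sum)

/-- `θ(V)`: the lexicographically largest column `W ≤ V` with column sum `r` (greedy from the
top); its partial sums are `min r` of the partial sums of `V`. -/
def theta (r : ℕ) {ℓ : ℕ} (V : Fin ℓ → ℕ) : Fin ℓ → ℕ := fun i =>
  min r (∑ i' ∈ Finset.univ.filter (fun i' : Fin ℓ => i' ≤ i), V i')
    - min r (∑ i' ∈ Finset.univ.filter (fun i' : Fin ℓ => i' < i), V i')

/-- `Δ(V) := V - θ(V)`. -/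
def delta (r : ℕ) {ℓ : ℕ} (V : Fin ℓ → ℕ) : Fin ℓ → ℕ := fun i => V i - theta r V i

/-- Auxiliary fuelled construction of `A(V)`. -/
def AVaux (r : ℕ) {ℓ : ℕ} : ℕ → (Fin ℓ → ℕ) → List (Fin ℓ → ℕ)
  | 0, _ => []
  | (k + 1), V => theta r V :: AVaux r k (delta r V)

/-- `A(V)`: the lexicographically largest matrix with `w_r(V)` columns, each of column sum
`r`, summing to `V`, with columns in weakly decreasing lexicographic order; obtained by
greedily splitting off `θ(V)`. -/
def AV (r : ℕ) {ℓ : ℕ} (V : Fin ℓ → ℕ) : List (Fin ℓ → ℕ) :=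
  AVaux r ((∑ i, V i) / r) V

/-- `S(V)`: the smallest set of matrices containing `A(V)` and closed under replacing two
consecutive columns by their sum. -/
inductive SV (r : ℕ) {ℓ : ℕ} (V : Fin ℓ → ℕ) : List (Fin ℓ → ℕ) → Prop
  | base : SV r V (AV r V)
  | merge (L₁ L₂ : List (Fin ℓ → ℕ)) (W₁ W₂ : Fin ℓ → ℕ) :
      SV r V (L₁ ++ W₁ :: W₂ :: L₂) → SV r V (L₁ ++ (fun i => W₁ i + W₂ i) :: L₂)

/-- `S(A)` for `A = A₁⋯A_k`: all concatenations `B⁽¹⁾⋯B⁽ᵏ⁾` with `B⁽ᶜ⁾ ∈ S(A_c)`. -/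
inductive SA (r : ℕ) {ℓ : ℕ} : List (Fin ℓ → ℕ) → List (Fin ℓ → ℕ) → Prop
  | nil : SA r [] []
  | cons {V : Fin ℓ → ℕ} {A B L : List (Fin ℓ → ℕ)} :
      SV r V B → SA r A L → SA r (V :: A) (B ++ L)

/-- Fuelled recursive definition of the polynomials `G_A`.  If `A` has no zero column
(in particular if it is an `r`-composition-matrix), `G_A := Σ_{B ∈ S(A)} M_B`.  Otherwise,
writing `A = B 0 V C` with `0` the last zero column (at 0-based position `j`), `V` the next
column and `C` the rest, `G_A := G_{BVC} - X_{j+1}^{θ(V)} · G_{BΔ(V)C}` (junk value `0` in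
the degenerate cases where the decomposition does not exist). -/
noncomputable def Gaux (r n : ℕ) {ℓ : ℕ} : ℕ → List (Fin ℓ → ℕ) → PolyR ℓ n
  | 0, _ => 0
  | (fuel + 1), A =>
    if hz : (Finset.univ.filter (fun c : Fin A.length => A.get c = 0)).Nonempty then
      let j := (Finset.univ.filter (fun c : Fin A.length => A.get c = 0)).max' hz
      if hj : (j : ℕ) + 1 < A.length then
        if hn : (j : ℕ) < n then
          let V := A.get ⟨(j : ℕ) + 1, hj⟩
          Gaux r n fuel (A.take (j : ℕ) ++ V :: A.drop ((j : ℕ) + 2))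
            - ((∏ i : Fin ℓ, MvPolynomial.X (i, (⟨(j : ℕ), hn⟩ : Fin n)) ^ theta r V i : PolyR ℓ n))
              * Gaux r n fuel (A.take (j : ℕ) ++ delta r V :: A.drop ((j : ℕ) + 2))
        else 0
      else 0
    else ∑ᶠ B ∈ {B : List (Fin ℓ → ℕ) | SA r A B}, Mlist n B

/-- The polynomial `G_A`. -/
noncomputable def G (r n : ℕ) {ℓ : ℕ} (A : List (Fin ℓ → ℕ)) : PolyR ℓ n :=
  Gaux r n (A.length + 1) A

/-- The recursive definition of `G` applies to `A`: either `A` is an `r`-composition-matrix,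
or `A = B 0 V C` with `V ≠ 0`, no zero column in `C` (so the displayed `0` is the last zero
column), and the definition applies to `B V C` and to `B Δ(V) C`. -/
inductive GDef (r : ℕ) {ℓ : ℕ} : List (Fin ℓ → ℕ) → Prop
  | comp {A : List (Fin ℓ → ℕ)} : IsRCompList r A → GDef r A
  | step {B : List (Fin ℓ → ℕ)} {V : Fin ℓ → ℕ} {C : List (Fin ℓ → ℕ)} :
      V ≠ 0 → (∀ W ∈ C, W ≠ 0) →
      GDef r (B ++ V :: C) → GDef r (B ++ delta r V :: C) →
      GDef r (B ++ (0 : Fin ℓ → ℕ) :: V :: C)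

/-- The position of the variable `x_{ij}` in the order
`x_{11} > x_{21} > … > x_{ℓ1} > x_{12} > … > x_{ℓn}` (smaller index = greater variable). -/
def varIdx {ℓ n : ℕ} (p : Fin ℓ × Fin n) : ℕ := (p.2 : ℕ) * ℓ + (p.1 : ℕ)

/-- `monLt m m'`: the monomial with exponent vector `m` is strictly smaller than the one with
exponent vector `m'` in the lexicographic order on monomials determined by `varIdx`. -/
def monLt {ℓ n : ℕ} (m m' : (Fin ℓ × Fin n) →₀ ℕ) : Prop :=
  ∃ p : Fin ℓ × Fin n, m p < m' p ∧ ∀ q : Fin ℓ × Fin n, varIdx q < varIdx p → m q = m' q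

/-- The exponent vector of the monomial `X^A`, for `A` a list of columns (of length `≤ n`). -/
noncomputable def expList {ℓ n : ℕ} (A : List (Fin ℓ → ℕ)) : (Fin ℓ × Fin n) →₀ ℕ :=
  Finsupp.equivFunOnFinite.symm
    (fun p => if h : (p.2 : ℕ) < A.length then A.get ⟨p.2, h⟩ p.1 else 0)

/-- The ideal `J` generated by the monomial quasi-invariants `M_A`, for `A` an
`r`-composition-matrix with `ℓ` rows and at most `n` columns. -/
noncomputable def Jdeal (r n ℓ : ℕ) : Ideal (PolyR ℓ n) :=
  Ideal.span {f | ∃ A : List (Fin ℓ → ℕ), IsRCompList r A ∧ A.length ≤ n ∧ f = Mlist n A}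

section ColumnSplitting

variable {ℓ : ℕ} (r : ℕ)

lemma sum_theta_lt (V : Fin ℓ → ℕ) (m : ℕ) (hm : m ≤ ℓ) :
    ∑ i ∈ Finset.univ.filter (fun i : Fin ℓ => (i : ℕ) < m), theta r V i =
      min r (∑ i ∈ Finset.univ.filter (fun i : Fin ℓ => (i : ℕ) < m), V i) := by
  induction m with
  | zero => simp
  | succ m ih =>
    have hins : Finset.univ.filter (fun i : Fin ℓ => (i : ℕ) < m + 1) =
        insert ⟨m, hm⟩ (Finset.univ.filter (fun i : Fin ℓ => (i : ℕ) < m)) := by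
      ext i
      simp only [Finset.mem_filter, Finset.mem_univ, true_and, Finset.mem_insert, Fin.ext_iff]
      omega
    have hnot : (⟨m, hm⟩ : Fin ℓ) ∉ Finset.univ.filter (fun i : Fin ℓ => (i : ℕ) < m) := by simp
    have hle : Finset.univ.filter (fun i : Fin ℓ => i ≤ ⟨m, hm⟩) =
        Finset.univ.filter (fun i : Fin ℓ => (i : ℕ) < m + 1) := by
      ext i; simp [Fin.le_def]
    have hlt : Finset.univ.filter (fun i : Fin ℓ => i < ⟨m, hm⟩) =
        Finset.univ.filter (fun i : Fin ℓ => (i : ℕ) < m) := by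
      ext i; simp [Fin.lt_def]
    have hθ : theta r V ⟨m, hm⟩ =
        min r (V ⟨m, hm⟩ + ∑ i ∈ Finset.univ.filter (fun i : Fin ℓ => (i : ℕ) < m), V i) -
          min r (∑ i ∈ Finset.univ.filter (fun i : Fin ℓ => (i : ℕ) < m), V i) := by
      rw [theta, hle, hlt, hins, Finset.sum_insert hnot]
    rw [hins, Finset.sum_insert hnot, Finset.sum_insert hnot, ih (by omega), hθ]
    omega

lemma sum_theta (V : Fin ℓ → ℕ) : ∑ i, theta r V i = min r (∑ i, V i) := by
  have h := sum_theta_lt r V ℓ le_rfl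
  simpa using h

lemma theta_le (V : Fin ℓ → ℕ) (i : Fin ℓ) : theta r V i ≤ V i := by
  have hins : Finset.univ.filter (fun i' : Fin ℓ => i' ≤ i) =
      insert i (Finset.univ.filter (fun i' : Fin ℓ => i' < i)) := by
    ext i'
    simp [le_iff_eq_or_lt]
  rw [theta, hins, Finset.sum_insert (by simp)]
  omega

lemma theta_add_delta (V : Fin ℓ → ℕ) : theta r V + delta r V = V := by
  funext i
  have := theta_le r V i
  simp only [Pi.add_apply, delta]
  omega

lemma sum_delta (V : Fin ℓ → ℕ) : ∑ i, delta r V i = ∑ i, V i - r := by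
  have h := congrArg (fun W : Fin ℓ → ℕ => ∑ i, W i) (theta_add_delta r V)
  simp only [Pi.add_apply, Finset.sum_add_distrib, sum_theta] at h
  omega

lemma length_AVaux (k : ℕ) (V : Fin ℓ → ℕ) : (AVaux r k V).length = k := by
  induction k generalizing V with
  | zero => rfl
  | succ k ih => simp [AVaux, ih]

lemma sum_of_mem_AVaux (k : ℕ) (V : Fin ℓ → ℕ) (hV : k * r ≤ ∑ i, V i) :
    ∀ W ∈ AVaux r k V, ∑ i, W i = r := by
  induction k generalizing V with
  | zero => simp [AVaux]
  | succ k ih =>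
    rw [Nat.succ_mul] at hV
    intro W hW
    rcases List.mem_cons.1 hW with rfl | hW
    · rw [sum_theta]; omega
    · exact ih _ (by rw [sum_delta]; omega) W hW

lemma sum_AVaux (k : ℕ) (V : Fin ℓ → ℕ) (hV : ∑ i, V i = k * r) : (AVaux r k V).sum = V := by
  induction k generalizing V with
  | zero =>
    funext i
    have : ∑ i, V i = 0 := by simpa using hV
    simpa [AVaux] using ((Finset.sum_eq_zero_iff.1 this) i (Finset.mem_univ i)).symm
  | succ k ih =>
    rw [Nat.succ_mul] at hV
    rw [AVaux, List.sum_cons, ih _ (by rw [sum_delta]; omega), theta_add_delta]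

lemma length_AV (V : Fin ℓ → ℕ) : (AV r V).length = (∑ i, V i) / r := length_AVaux r _ V

lemma sum_of_mem_AV (V : Fin ℓ → ℕ) : ∀ W ∈ AV r V, ∑ i, W i = r :=
  sum_of_mem_AVaux r _ V (Nat.div_mul_le_self _ _)

lemma sum_AV (V : Fin ℓ → ℕ) (hV : r ∣ ∑ i, V i) : (AV r V).sum = V :=
  sum_AVaux r _ V (Nat.div_mul_cancel hV).symm

end ColumnSplitting

/-- Some nonempty initial segment of the list of weights has total weight exceeding its length
by at least `d`. -/
def ExceedsBy : ℕ → List ℕ → Prop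
  | _, [] => False
  | d, v :: C => d + 1 ≤ v ∨ ExceedsBy (d + 1 - v) C

lemma ExceedsBy.of_succ {d : ℕ} {C : List ℕ} (h : ExceedsBy (d + 1) C) : ExceedsBy d C := by
  induction C generalizing d with
  | nil => exact h
  | cons v C ih =>
    rcases h with h | h
    · exact Or.inl (by omega)
    · by_cases hv : d + 1 ≤ v
      · exact Or.inl hv
      · refine Or.inr (ih ?_)
        rwa [show d + 1 - v + 1 = d + 1 + 1 - v by omega]

lemma ExceedsBy.remove_zero {d : ℕ} {B C : List ℕ} {v : ℕ}
    (h : ExceedsBy d (B ++ 0 :: v :: C)) : ExceedsBy d (B ++ v :: C) := by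
  induction B generalizing d with
  | nil =>
    rcases h with h | h
    · omega
    · exact h.of_succ
  | cons b B ih => exact h.imp id ih

lemma ExceedsBy.remove_zero_pred {d : ℕ} {B C : List ℕ} {v : ℕ} (hv : 1 ≤ v)
    (h : ExceedsBy d (B ++ 0 :: v :: C)) : ExceedsBy d (B ++ (v - 1) :: C) := by
  induction B generalizing d with
  | nil =>
    rcases h with h | h | h
    · omega
    · exact Or.inl (by omega)
    · refine Or.inr ?_
      rwa [show d + 1 - (v - 1) = d + 1 - 0 + 1 - v by omega]
  | cons b B ih => exact h.imp id ih

lemma exceedsBy_of_le_sum_take (d j : ℕ) (C : List ℕ) (hj : 1 ≤ j) (hjC : j ≤ C.length)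
    (h : j + d ≤ (C.take j).sum) : ExceedsBy d C := by
  induction C generalizing d j with
  | nil => simp at hjC; omega
  | cons v C ih =>
    obtain ⟨j, rfl⟩ : ∃ i, j = i + 1 := ⟨j - 1, by omega⟩
    simp only [List.take_succ_cons, List.sum_cons, List.length_cons] at h hjC
    by_cases hv : d + 1 ≤ v
    · exact Or.inl hv
    · refine Or.inr (ih _ j ?_ (by omega) (by omega))
      by_contra h0
      obtain rfl : j = 0 := by omega
      simp at h
      omega

/-- The `r`-size of a column. -/
def colWeight (r : ℕ) {ℓ : ℕ} (V : Fin ℓ → ℕ) : ℕ := (∑ i, V i) / r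

lemma IsTransMat.exceedsBy {r ℓ : ℕ} (hr : 1 ≤ r) {A : List (Fin ℓ → ℕ)}
    (hA : ∀ V ∈ A, r ∣ ∑ i, V i) (ht : IsTransMat r A) : ExceedsBy 0 (A.map (colWeight r)) := by
  obtain ⟨j, hj, hjA, h⟩ := ht
  refine exceedsBy_of_le_sum_take 0 j _ hj (by simpa using hjA) ?_
  have key : ∀ B : List (Fin ℓ → ℕ), (∀ V ∈ B, r ∣ ∑ i, V i) →
      (B.map fun V => ∑ i, V i).sum = r * (B.map (colWeight r)).sum := by
    intro B hB
    induction B with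
    | nil => simp
    | cons V B ih =>
      rw [List.map_cons, List.sum_cons, ih fun W hW => hB W (List.mem_cons_of_mem _ hW),
        List.map_cons, List.sum_cons, mul_add, colWeight,
        Nat.mul_div_cancel' (hB V List.mem_cons_self)]
  rw [key _ fun V hV => hA V (List.mem_of_mem_take hV)] at h
  rw [← List.map_take]
  exact Nat.le_of_mul_le_mul_left h hr

section Membership

variable {ℓ : ℕ} {r : ℕ}

lemma sum_ne_zero_of_ne_zero {V : Fin ℓ → ℕ} (h : V ≠ 0) : ∑ i, V i ≠ 0 := by
  contrapose! h
  funext i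
  exact Finset.sum_eq_zero_iff.1 h i (Finset.mem_univ i)

lemma SV.isRCompList (hr : 1 ≤ r) {V : Fin ℓ → ℕ} (hV : V ≠ 0) (hd : r ∣ ∑ i, V i)
    {B : List (Fin ℓ → ℕ)} (hB : SV r V B) : IsRCompList r B := by
  induction hB with
  | base =>
    constructor
    · intro h
      have hl := length_AV r V
      rw [h, List.length_nil] at hl
      have := Nat.div_mul_cancel hd
      rw [← hl, zero_mul] at this
      exact sum_ne_zero_of_ne_zero hV this.symm
    · intro W hW
      rw [sum_of_mem_AV r V W hW]
      exact ⟨by omega, dvd_rfl⟩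
  | merge L₁ L₂ W₁ W₂ _ ih =>
    obtain ⟨-, ih⟩ := ih
    refine ⟨by simp, fun W hW => ?_⟩
    have h₁ := ih W₁ (by simp)
    have h₂ := ih W₂ (by simp)
    simp only [List.mem_append, List.mem_cons] at hW
    rcases hW with hW | rfl | hW
    · exact ih W (by simp [hW])
    · rw [Finset.sum_add_distrib]
      exact ⟨by omega, dvd_add h₁.2 h₂.2⟩
    · exact ih W (by simp [hW])

lemma SA.columns (hr : 1 ≤ r) {A B : List (Fin ℓ → ℕ)} (hB : SA r A B)
    (hA : ∀ V ∈ A, V ≠ 0 ∧ r ∣ ∑ i, V i) :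
    (A ≠ [] → B ≠ []) ∧ ∀ V ∈ B, (∑ i, V i) ≠ 0 ∧ r ∣ ∑ i, V i := by
  induction hB with
  | nil => simp
  | cons hV _ ih =>
    rw [List.forall_mem_cons] at hA
    have h := hV.isRCompList hr hA.1.1 hA.1.2
    refine ⟨fun _ => by simp [h.1], fun W hW => ?_⟩
    rcases List.mem_append.1 hW with hW | hW
    · exact h.2 W hW
    · exact (ih hA.2).2 W hW

lemma Mlist_mem_Jdeal (n : ℕ) {B : List (Fin ℓ → ℕ)} (hB : IsRCompList r B) :
    Mlist n B ∈ Jdeal r n ℓ := by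
  by_cases hl : B.length ≤ n
  · exact Ideal.subset_span ⟨B, hB, hl, rfl⟩
  · have : Mlist n B = 0 := by
      refine Finset.sum_eq_zero fun s hs => ?_
      have := Fintype.card_le_of_injective s (Finset.mem_filter.1 hs).2.injective
      simp at this
      omega
    rw [this]
    exact zero_mem _

lemma Gaux_mem_Jdeal (hr : 1 ≤ r) (n fuel : ℕ) (A : List (Fin ℓ → ℕ))
    (hA : ∀ V ∈ A, r ∣ ∑ i, V i) (ht : ExceedsBy 0 (A.map (colWeight r))) :
    Gaux r n fuel A ∈ Jdeal r n ℓ := by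
  induction fuel generalizing A with
  | zero => exact zero_mem _
  | succ fuel ih =>
    rw [Gaux]
    split_ifs with hz
    · extract_lets j
      split_ifs with hj hn
      · extract_lets V
        have hj0 : A[(j : ℕ)] = 0 := (Finset.mem_filter.1 (Finset.max'_mem _ hz)).2
        have hsplit : A = A.take j ++ 0 :: V :: A.drop (j + 2) := by
          conv_lhs => rw [← List.take_append_drop j A]
          rw [List.drop_eq_getElem_cons j.2, hj0, List.drop_eq_getElem_cons hj]
          rfl
        have hV0 : V ≠ 0 := by
          intro hV
          have hle := Finset.le_max' (Finset.univ.filter fun c : Fin A.length => A.get c = 0)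
            ⟨j + 1, hj⟩ (Finset.mem_filter.2 ⟨Finset.mem_univ _, hV⟩)
          have : (j : ℕ) + 1 ≤ j := hle
          omega
        generalize A.take j = B at hsplit
        generalize A.drop (j + 2) = C at hsplit
        rw [hsplit] at hA ht
        simp only [List.forall_mem_append, List.forall_mem_cons] at hA
        obtain ⟨hB, -, hV, hC⟩ := hA
        simp only [List.map_append, List.map_cons] at ht
        rw [show colWeight r (0 : Fin ℓ → ℕ) = 0 by simp [colWeight]] at ht
        have hpos : 1 ≤ colWeight r V := by
          rw [colWeight, Nat.one_le_div_iff (by omega)]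
          exact Nat.le_of_dvd (Nat.pos_of_ne_zero (sum_ne_zero_of_ne_zero hV0)) hV
        have hδ : colWeight r (delta r V) = colWeight r V - 1 := by
          rw [colWeight, colWeight, sum_delta]
          obtain ⟨k, hk⟩ := hV
          rw [hk, ← Nat.mul_sub_one, Nat.mul_div_cancel_left _ hr, Nat.mul_div_cancel_left _ hr]
        refine sub_mem (ih _ ?_ ?_) (Ideal.mul_mem_left _ _ (ih _ ?_ ?_))
        · simp only [List.forall_mem_append, List.forall_mem_cons]
          exact ⟨hB, hV, hC⟩
        · simpa using ht.remove_zero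
        · simp only [List.forall_mem_append, List.forall_mem_cons]
          refine ⟨hB, ?_, hC⟩
          rw [sum_delta]
          exact Nat.dvd_sub hV dvd_rfl
        · simpa [hδ] using ht.remove_zero_pred hpos
      · exact zero_mem _
      · exact zero_mem _
    · have hA' : ∀ V ∈ A, V ≠ 0 ∧ r ∣ ∑ i, V i := by
        refine fun V hV => ⟨fun h0 => hz ?_, hA V hV⟩
        obtain ⟨c, hc⟩ := List.mem_iff_get.1 hV
        exact ⟨c, Finset.mem_filter.2 ⟨Finset.mem_univ _, hc.trans h0⟩⟩
      have hne : A ≠ [] := by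
        rintro rfl
        exact ht
      refine finsum_mem_induction (· ∈ Jdeal r n ℓ) (zero_mem _) (fun _ _ => add_mem) ?_
      intro B hB
      have h := SA.columns hr hB hA'
      exact Mlist_mem_Jdeal n ⟨h.1 hne, h.2⟩

end Membership

section LeadingMonomial

variable {ℓ n : ℕ}

/-- The exponent vector of the monomial whose only nonzero column is `V`, at position `k`. -/
def colExp (n k : ℕ) (V : Fin ℓ → ℕ) : (Fin ℓ × Fin n) →₀ ℕ :=
  Finsupp.equivFunOnFinite.symm fun p => if (p.2 : ℕ) = k then V p.1 else 0

lemma colExp_apply (k : ℕ) (V : Fin ℓ → ℕ) (p : Fin ℓ × Fin n) :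
    colExp n k V p = if (p.2 : ℕ) = k then V p.1 else 0 := rfl

/-- The monomial `X_k^V`. -/
def colMon (n k : ℕ) (V : Fin ℓ → ℕ) : PolyR ℓ n := MvPolynomial.monomial (colExp n k V) 1

lemma colExp_add (k : ℕ) (U V : Fin ℓ → ℕ) :
    colExp n k (U + V) = colExp n k U + colExp n k V := by
  ext p
  simp only [Finsupp.add_apply, colExp_apply, Pi.add_apply]
  split_ifs <;> rfl

lemma colExp_zero (k : ℕ) : colExp n k (0 : Fin ℓ → ℕ) = 0 := by
  ext p
  simp [colExp_apply]

lemma colMon_add (k : ℕ) (U V : Fin ℓ → ℕ) :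
    colMon n k (U + V) = colMon n k U * colMon n k V := by
  rw [colMon, colMon, colMon, MvPolynomial.monomial_mul, colExp_add, one_mul]

lemma prod_X_pow_eq_colMon (j : Fin n) (V : Fin ℓ → ℕ) :
    (∏ i, MvPolynomial.X (i, j) ^ V i : PolyR ℓ n) = colMon n j V := by
  rw [colMon, MvPolynomial.monomial_eq, Finsupp.prod_fintype _ _ (by simp), Fintype.prod_prod_type]
  simp only [colExp_apply, map_one, one_mul, ← Fin.ext_iff]
  refine Finset.prod_congr rfl fun i _ => ?_
  rw [Finset.prod_eq_single j] <;> simp +contextual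

/-- The sum defining a monomial quasi-invariant, restricted to the columns of variables
`X_k, X_{k+1}, …` (counted from `0`). -/
def monSum (n k : ℕ) {N : ℕ} (B : Fin N → Fin ℓ → ℕ) : PolyR ℓ n :=
  ∑ s ∈ Finset.univ.filter (fun s : Fin N → Fin n => StrictMono s ∧ ∀ c, k ≤ (s c : ℕ)),
    ∏ c, colMon n (s c) (B c)

lemma monSum_nil (k : ℕ) (B : Fin 0 → Fin ℓ → ℕ) : monSum n k B = 1 := by
  have : Finset.univ.filter (fun s : Fin 0 → Fin n => StrictMono s ∧ ∀ c, k ≤ (s c : ℕ)) =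
      Finset.univ := by
    refine Finset.filter_true_of_mem fun s _ => ⟨fun a => a.elim0, fun a => a.elim0⟩
  rw [monSum, this]
  simp

lemma monSum_of_le {k N : ℕ} (hk : n ≤ k) (B : Fin (N + 1) → Fin ℓ → ℕ) : monSum n k B = 0 := by
  refine Finset.sum_eq_zero fun s hs => ?_
  have := (Finset.mem_filter.1 hs).2.2 0
  omega

lemma monSum_succ {k N : ℕ} (hk : k < n) (B : Fin (N + 1) → Fin ℓ → ℕ) :
    monSum n k B = monSum n (k + 1) B + colMon n k (B 0) * monSum n (k + 1) (Fin.tail B) := by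
  rw [monSum, ← Finset.sum_filter_not_add_sum_filter _ (fun s => s 0 = ⟨k, hk⟩)]
  congr 1
  · rw [monSum, Finset.filter_filter]
    refine Finset.sum_congr (Finset.filter_congr fun s _ => ?_) fun _ _ => rfl
    constructor
    · rintro ⟨⟨hs, hks⟩, hne⟩
      refine ⟨hs, fun c => ?_⟩
      have h0 := hks 0
      have h1 : (s 0 : ℕ) ≠ k := fun h => hne (Fin.ext h)
      have h2 : (s 0 : ℕ) ≤ s c := hs.monotone (Fin.zero_le c)
      omega
    · rintro ⟨hs, hks⟩
      refine ⟨⟨hs, fun c => (Nat.le_succ k).trans (hks c)⟩, fun h => ?_⟩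
      have := hks 0
      rw [h] at this
      simp at this
  · rw [monSum, Finset.filter_filter, Finset.mul_sum]
    refine Finset.sum_nbij' Fin.tail (fun s => Fin.cons ⟨k, hk⟩ s) ?_ ?_ ?_ ?_ ?_
    · intro s hs
      obtain ⟨⟨hs, -⟩, h0⟩ := (Finset.mem_filter.1 hs).2
      refine Finset.mem_filter.2 ⟨Finset.mem_univ _, fun a b hab => hs (Fin.succ_lt_succ_iff.2 hab),
        fun c => ?_⟩
      have h1 : (s 0 : ℕ) < s c.succ := hs (Fin.succ_pos c)
      rw [h0] at h1
      exact h1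
    · intro s hs
      obtain ⟨hs, hks⟩ := (Finset.mem_filter.1 hs).2
      refine Finset.mem_filter.2 ⟨Finset.mem_univ _, ⟨?_, fun c => ?_⟩, rfl⟩
      · intro a b hab
        obtain ⟨b, rfl⟩ := Fin.exists_succ_eq.2 (Fin.pos_iff_ne_zero.1 ((Fin.zero_le a).trans_lt hab))
        cases a using Fin.cases with
        | zero => exact hks b
        | succ a => exact hs (Fin.succ_lt_succ_iff.1 hab)
      · cases c using Fin.cases with
        | zero => exact le_rfl
        | succ c => exact (Nat.le_succ k).trans (hks c)
    · intro s hs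
      rw [← (Finset.mem_filter.1 hs).2.2]
      exact Fin.cons_self_tail s
    · intro s _
      exact Fin.tail_cons _ _
    · intro s hs
      rw [Fin.prod_univ_succ, (Finset.mem_filter.1 hs).2.2]
      rfl

/-- The monomial quasi-invariant of `B` in the `m` columns of variables `X_k, …, X_{k+m-1}`. -/
def monQI (n : ℕ) {ℓ : ℕ} : ℕ → ℕ → List (Fin ℓ → ℕ) → PolyR ℓ n
  | _, _, [] => 1
  | 0, _, _ :: _ => 0
  | m + 1, k, V :: B => monQI n m (k + 1) (V :: B) + colMon n k V * monQI n m (k + 1) B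

lemma monQI_nil (m k : ℕ) : monQI n m k ([] : List (Fin ℓ → ℕ)) = 1 := by cases m <;> rfl

lemma monQI_eq_monSum (m k : ℕ) (hk : k + m = n) (B : List (Fin ℓ → ℕ)) :
    monQI n m k B = monSum n k B.get := by
  induction m generalizing k B with
  | zero =>
    cases B with
    | nil => exact (monQI_nil _ _).trans (monSum_nil k _).symm
    | cons V B => exact (monSum_of_le (by omega) _).symm
  | succ m ih =>
    cases B with
    | nil => exact (monQI_nil _ _).trans (monSum_nil k _).symm
    | cons V B =>
      rw [monQI, ih _ (by omega), ih _ (by omega)]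
      exact (monSum_succ (by omega) (V :: B).get).symm

lemma monQI_eq_Mlist (B : List (Fin ℓ → ℕ)) : monQI n n 0 B = Mlist n B := by
  rw [monQI_eq_monSum n 0 (by omega), monSum, Mlist]
  simp only [Nat.zero_le, implies_true, and_true]
  exact Finset.sum_congr rfl fun s _ =>
    Finset.prod_congr rfl fun c _ => (prod_X_pow_eq_colMon (s c) _).symm

/-- All lists of columns obtained by merging consecutive columns of the block `U :: b` and
appending a member of `L`. -/
def mergeBlock (U : Fin ℓ → ℕ) :
    List (Fin ℓ → ℕ) → List (List (Fin ℓ → ℕ)) → List (List (Fin ℓ → ℕ))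
  | [], L => L.map (U :: ·)
  | t :: b, L => (mergeBlock t b L).map (U :: ·) ++ mergeBlock (U + t) b L

/-- All lists of columns obtained by merging consecutive columns inside the blocks of `C`. -/
def mergeBlocks : List (List (Fin ℓ → ℕ)) → List (List (Fin ℓ → ℕ))
  | [] => [[]]
  | [] :: C => mergeBlocks C
  | (t :: b) :: C => mergeBlock t b (mergeBlocks C)

/-- The sum of the monomial quasi-invariants of the members of `L`. -/
def qiSum (n m k : ℕ) (L : List (List (Fin ℓ → ℕ))) : PolyR ℓ n := (L.map (monQI n m k)).sum

/-- The part of the sum over `mergeBlock U b L` divisible by `X_k^U`, divided by `X_k^U`. -/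
def qiHead (n m k : ℕ) (L : List (List (Fin ℓ → ℕ))) : List (Fin ℓ → ℕ) → PolyR ℓ n
  | [] => qiSum n m (k + 1) L
  | t :: b => qiSum n m (k + 1) (mergeBlock t b L) + colMon n k t * qiHead n m k L b

lemma qiSum_append (m k : ℕ) (L L' : List (List (Fin ℓ → ℕ))) :
    qiSum n m k (L ++ L') = qiSum n m k L + qiSum n m k L' := by
  simp [qiSum]

lemma qiSum_map_cons (m k : ℕ) (U : Fin ℓ → ℕ) (L : List (List (Fin ℓ → ℕ))) :
    qiSum n (m + 1) k (L.map (U :: ·)) =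
      qiSum n m (k + 1) (L.map (U :: ·)) + colMon n k U * qiSum n m (k + 1) L := by
  induction L with
  | nil => simp [qiSum]
  | cons B L ih =>
    simp only [qiSum, List.map_cons, List.sum_cons, monQI] at ih ⊢
    rw [ih]
    ring

lemma qiSum_mergeBlock (m k : ℕ) (U : Fin ℓ → ℕ) (b : List (Fin ℓ → ℕ))
    (L : List (List (Fin ℓ → ℕ))) :
    qiSum n (m + 1) k (mergeBlock U b L) =
      qiSum n m (k + 1) (mergeBlock U b L) + colMon n k U * qiHead n m k L b := by
  induction b generalizing U with
  | nil => exact qiSum_map_cons m k U L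
  | cons t b ih =>
    rw [mergeBlock, qiSum_append, qiSum_append, qiSum_map_cons, ih, qiHead, colMon_add]
    ring

/-- Rewriting a function on block lists when the first column of variables `X_k` is dropped. -/
def dropColumn (n k : ℕ) {ℓ : ℕ} (φ : List (List (Fin ℓ → ℕ)) → PolyR ℓ n) :
    List (List (Fin ℓ → ℕ)) → PolyR ℓ n
  | [] => φ []
  | [] :: C => dropColumn n k φ C
  | [t] :: C => φ ([t] :: C) - colMon n k t * dropColumn n k φ C
  | (t :: u :: b) :: C => φ ((t :: u :: b) :: C) - colMon n k t * φ ((u :: b) :: C)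

/-- The combination of values of `φ` at block lists without empty blocks obtained by removing
the empty blocks of `A`, the first block of `A` being attached to the variables `X_k`. -/
def removeEmpty (n : ℕ) {ℓ : ℕ} :
    ℕ → List (List (Fin ℓ → ℕ)) → (List (List (Fin ℓ → ℕ)) → PolyR ℓ n) → PolyR ℓ n
  | _, [], φ => φ []
  | k, [] :: A, φ => removeEmpty n (k + 1) A (dropColumn n k φ)
  | k, (t :: b) :: A, φ => removeEmpty n (k + 1) A fun C => φ ((t :: b) :: C)

lemma dropColumn_qiSum (m k : ℕ) (C : List (List (Fin ℓ → ℕ))) :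
    dropColumn n k (fun C => qiSum n (m + 1) k (mergeBlocks C)) C =
      qiSum n m (k + 1) (mergeBlocks C) := by
  induction C with
  | nil => simp [dropColumn, mergeBlocks, qiSum, monQI_nil]
  | cons b C ih =>
    match b with
    | [] => exact ih
    | [t] =>
      rw [dropColumn, ih, mergeBlocks, qiSum_mergeBlock, qiHead]
      ring
    | t :: u :: b =>
      rw [dropColumn, mergeBlocks, qiSum_mergeBlock, qiHead, mergeBlocks, qiSum_mergeBlock]
      ring

lemma dropColumn_add_mul (k : ℕ) (c : PolyR ℓ n) (φ ψ : List (List (Fin ℓ → ℕ)) → PolyR ℓ n)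
    (C : List (List (Fin ℓ → ℕ))) :
    dropColumn n k (fun C => φ C + c * ψ C) C = dropColumn n k φ C + c * dropColumn n k ψ C := by
  induction C with
  | nil => rfl
  | cons b C ih =>
    match b with
    | [] => exact ih
    | [t] =>
      simp only [dropColumn, ih]
      ring
    | t :: u :: b =>
      simp only [dropColumn]
      ring

lemma removeEmpty_nil (k : ℕ) (φ : List (List (Fin ℓ → ℕ)) → PolyR ℓ n) :
    removeEmpty n k [] φ = φ [] := rfl

lemma removeEmpty_nil_cons (k : ℕ) (A : List (List (Fin ℓ → ℕ)))
    (φ : List (List (Fin ℓ → ℕ)) → PolyR ℓ n) :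
    removeEmpty n k ([] :: A) φ = removeEmpty n (k + 1) A (dropColumn n k φ) := rfl

lemma removeEmpty_cons_cons (k : ℕ) (t : Fin ℓ → ℕ) (b : List (Fin ℓ → ℕ))
    (A : List (List (Fin ℓ → ℕ))) (φ : List (List (Fin ℓ → ℕ)) → PolyR ℓ n) :
    removeEmpty n k ((t :: b) :: A) φ = removeEmpty n (k + 1) A fun C => φ ((t :: b) :: C) := rfl

lemma removeEmpty_add_mul (k : ℕ) (A : List (List (Fin ℓ → ℕ))) (c : PolyR ℓ n)
    (φ ψ : List (List (Fin ℓ → ℕ)) → PolyR ℓ n) :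
    removeEmpty n k A (fun C => φ C + c * ψ C) =
      removeEmpty n k A φ + c * removeEmpty n k A ψ := by
  induction A generalizing k φ ψ with
  | nil => rw [removeEmpty_nil, removeEmpty_nil, removeEmpty_nil]
  | cons b A ih =>
    rcases b with - | ⟨t, b⟩
    · have h : dropColumn n k (fun C => φ C + c * ψ C) =
          fun C => dropColumn n k φ C + c * dropColumn n k ψ C :=
        funext fun C => dropColumn_add_mul k c φ ψ C
      rw [removeEmpty_nil_cons, removeEmpty_nil_cons, removeEmpty_nil_cons, h]
      exact ih (k + 1) (dropColumn n k φ) (dropColumn n k ψ)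
    · rw [removeEmpty_cons_cons, removeEmpty_cons_cons, removeEmpty_cons_cons]
      exact ih (k + 1) (fun C => φ ((t :: b) :: C)) fun C => ψ ((t :: b) :: C)

lemma removeEmpty_mem (S : AddSubgroup (PolyR ℓ n)) {P : (Fin ℓ → ℕ) → Prop}
    (A : List (List (Fin ℓ → ℕ))) (hA : ∀ b ∈ A, ∀ t ∈ b, P t) (k : ℕ)
    (φ : List (List (Fin ℓ → ℕ)) → PolyR ℓ n)
    (hS : ∀ j, k ≤ j → ∀ t, ∀ p ∈ S, colMon n j t * p ∈ S)
    (hφ : ∀ C : List (List (Fin ℓ → ℕ)), (∀ b ∈ C, ∀ t ∈ b, P t) → φ C ∈ S) :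
    removeEmpty n k A φ ∈ S := by
  induction A generalizing k φ with
  | nil => exact hφ [] (by simp)
  | cons b A ih =>
    rw [List.forall_mem_cons] at hA
    have hS' : ∀ j, k + 1 ≤ j → ∀ t, ∀ p ∈ S, colMon n j t * p ∈ S :=
      fun j hj => hS j (by omega)
    match b, hA.1 with
    | [], _ =>
      refine ih hA.2 _ _ hS' fun C hC => ?_
      induction C with
      | nil => exact hφ [] hC
      | cons b C ihC =>
        have hC' := List.forall_mem_cons.1 hC
        match b with
        | [] => exact ihC hC'.2
        | [t] => exact sub_mem (hφ _ hC) (hS k le_rfl _ _ (ihC hC'.2))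
        | t :: u :: b =>
          exact sub_mem (hφ _ hC) (hS k le_rfl _ _ (hφ _
            (List.forall_mem_cons.2 ⟨(List.forall_mem_cons.1 hC'.1).2, hC'.2⟩)))
    | t :: b, hb =>
      exact ih hA.2 _ _ hS' fun C hC => hφ _ (List.forall_mem_cons.2 ⟨hb, hC⟩)

lemma dropColumn_mem_of_exceedsBy (J : Ideal (PolyR ℓ n)) {P : (Fin ℓ → ℕ) → Prop} (k d : ℕ)
    (φ : List (List (Fin ℓ → ℕ)) → PolyR ℓ n)
    (hφ : ∀ C : List (List (Fin ℓ → ℕ)), (∀ b ∈ C, ∀ t ∈ b, P t) →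
      ExceedsBy d (C.map List.length) → φ C ∈ J)
    (C : List (List (Fin ℓ → ℕ))) (hP : ∀ b ∈ C, ∀ t ∈ b, P t)
    (hC : ExceedsBy (d + 1) (C.map List.length)) :
    dropColumn n k φ C ∈ J := by
  induction C with
  | nil => exact hC.elim
  | cons b C ih =>
    have hP' := List.forall_mem_cons.1 hP
    match b with
    | [] =>
      rcases hC with hC | hC
      · simp at hC
      · exact ih hP'.2 hC.of_succ
    | [t] =>
      refine sub_mem (hφ _ hP hC.of_succ) (J.mul_mem_left _ (ih hP'.2 ?_))
      rcases hC with hC | hC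
      · simp at hC
      · exact hC
    | t :: u :: b =>
      refine sub_mem (hφ _ hP hC.of_succ) (J.mul_mem_left _ (hφ _
        (List.forall_mem_cons.2 ⟨(List.forall_mem_cons.1 hP'.1).2, hP'.2⟩) ?_))
      refine hC.imp (fun h => ?_) fun h => ?_
      · simp at h ⊢
        omega
      · simpa [Nat.add_sub_add_right] using h

lemma removeEmpty_mem_of_exceedsBy (J : Ideal (PolyR ℓ n)) {P : (Fin ℓ → ℕ) → Prop}
    (A : List (List (Fin ℓ → ℕ))) (hP : ∀ b ∈ A, ∀ t ∈ b, P t) (k d : ℕ)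
    (φ : List (List (Fin ℓ → ℕ)) → PolyR ℓ n)
    (hφ : ∀ C : List (List (Fin ℓ → ℕ)), (∀ b ∈ C, ∀ t ∈ b, P t) →
      ExceedsBy d (C.map List.length) → φ C ∈ J)
    (hA : ExceedsBy d (A.map List.length)) :
    removeEmpty n k A φ ∈ J := by
  induction A generalizing k d φ with
  | nil => exact hA.elim
  | cons b A ih =>
    rw [List.forall_mem_cons] at hP
    match b, hP.1 with
    | [], _ =>
      rcases hA with hA | hA
      · simp at hA
      · exact ih hP.2 _ _ _ (dropColumn_mem_of_exceedsBy J k d φ hφ) hA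
    | t :: b, hb =>
      rcases hA with hA | hA
      · exact removeEmpty_mem J.toAddSubgroup A hP.2 _ _
          (fun j _ t p hp => J.mul_mem_left _ hp)
          fun C hC => hφ _ (List.forall_mem_cons.2 ⟨hb, hC⟩) (Or.inl hA)
      · exact ih hP.2 _ _ _ (fun C hC hCd =>
          hφ _ (List.forall_mem_cons.2 ⟨hb, hC⟩) (Or.inr hCd)) hA

/-- The polynomials in the columns of variables `X_k, X_{k+1}, …`. -/
def fromColumn (ℓ n k : ℕ) : Subalgebra ℚ (PolyR ℓ n) :=
  MvPolynomial.supported ℚ {q : Fin ℓ × Fin n | k ≤ (q.2 : ℕ)}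

lemma fromColumn_succ_le (k : ℕ) : fromColumn ℓ n (k + 1) ≤ fromColumn ℓ n k :=
  MvPolynomial.supported_mono fun _ hq => Nat.le_of_succ_le hq

lemma colMon_mem_fromColumn {k j : ℕ} (hj : k ≤ j) (V : Fin ℓ → ℕ) :
    colMon n j V ∈ fromColumn ℓ n k := by
  rw [fromColumn, MvPolynomial.mem_supported, colMon, MvPolynomial.vars_monomial one_ne_zero]
  intro q hq
  rw [Finset.mem_coe, Finsupp.mem_support_iff, colExp_apply] at hq
  have : (q.2 : ℕ) = j := by
    by_contra h
    exact hq (if_neg h)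
  exact hj.trans this.ge

lemma apply_eq_zero_of_mem_fromColumn {k : ℕ} {p : PolyR ℓ n} (hp : p ∈ fromColumn ℓ n k)
    {m : (Fin ℓ × Fin n) →₀ ℕ} (hm : m ∈ p.support) {q : Fin ℓ × Fin n} (hq : (q.2 : ℕ) < k) :
    m q = 0 := by
  by_contra h
  have hv : q ∈ p.vars :=
    (MvPolynomial.mem_vars_iff_mem_support q).2 ⟨m, hm, Finsupp.mem_support_iff.2 h⟩
  have : k ≤ (q.2 : ℕ) := MvPolynomial.mem_supported.1 hp hv
  omega

lemma monQI_mem_fromColumn (m k : ℕ) (B : List (Fin ℓ → ℕ)) :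
    monQI n m k B ∈ fromColumn ℓ n k := by
  induction m generalizing k B with
  | zero =>
    cases B with
    | nil => exact one_mem _
    | cons V B => exact zero_mem _
  | succ m ih =>
    cases B with
    | nil => exact one_mem _
    | cons V B =>
      exact add_mem (fromColumn_succ_le k (ih _ _))
        (mul_mem (colMon_mem_fromColumn le_rfl V) (fromColumn_succ_le k (ih _ _)))

lemma qiSum_mem_fromColumn (m k : ℕ) (L : List (List (Fin ℓ → ℕ))) :
    qiSum n m k L ∈ fromColumn ℓ n k := by
  refine list_sum_mem fun p hp => ?_
  obtain ⟨B, -, rfl⟩ := List.mem_map.1 hp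
  exact monQI_mem_fromColumn m k B

/-- The monomial with exponent vector `e` is the greatest monomial of `p`. -/
def IsLeading (p : PolyR ℓ n) (e : (Fin ℓ × Fin n) →₀ ℕ) : Prop :=
  p.coeff e ≠ 0 ∧ ∀ m ∈ p.support, m ≠ e → monLt m e

lemma IsLeading.monomial_mul {p : PolyR ℓ n} {e : (Fin ℓ × Fin n) →₀ ℕ} (h : IsLeading p e)
    (s : (Fin ℓ × Fin n) →₀ ℕ) : IsLeading (MvPolynomial.monomial s 1 * p) (s + e) := by
  refine ⟨by simpa [MvPolynomial.coeff_monomial_mul] using h.1, fun m hm hne => ?_⟩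
  rw [MvPolynomial.mem_support_iff, MvPolynomial.coeff_monomial_mul'] at hm
  split_ifs at hm with hs
  · obtain ⟨m, rfl⟩ := exists_add_of_le hs
    rw [add_tsub_cancel_left, one_mul] at hm
    obtain ⟨q, hlt, heq⟩ := h.2 m (MvPolynomial.mem_support_iff.2 hm) fun h => hne (by rw [h])
    exact ⟨q, by simpa using hlt, fun q' hq' => by simp [heq q' hq']⟩
  · exact absurd rfl hm

lemma IsLeading.add_of_forall_monLt {p R : PolyR ℓ n} {e : (Fin ℓ × Fin n) →₀ ℕ}
    (h : IsLeading p e) (hR : ∀ m ∈ R.support, monLt m e) : IsLeading (R + p) e := by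
  constructor
  · have : R.coeff e = 0 := by
      by_contra hne
      obtain ⟨q, hq, -⟩ := hR e (MvPolynomial.mem_support_iff.2 hne)
      exact lt_irrefl _ hq
    rw [MvPolynomial.coeff_add, this, zero_add]
    exact h.1
  · intro m hm hne
    rcases Finset.mem_union.1 (MvPolynomial.support_add hm) with hm | hm
    · exact hR m hm
    · exact h.2 m hm hne

lemma varIdx_lt_imp {q p : Fin ℓ × Fin n} (h : varIdx q < varIdx p) :
    (q.2 : ℕ) < p.2 ∨ (q.2 : ℕ) = p.2 ∧ (q.1 : ℕ) < p.1 := by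
  unfold varIdx at h
  have h1 := q.1.2
  have h2 := p.1.2
  rcases lt_trichotomy (q.2 : ℕ) p.2 with hlt | heq | hgt
  · exact Or.inl hlt
  · rw [heq] at h
    exact Or.inr ⟨heq, by omega⟩
  · have : ((p.2 : ℕ) + 1) * ℓ ≤ q.2 * ℓ := Nat.mul_le_mul_right _ hgt
    rw [Nat.succ_mul] at this
    omega

lemma monLt_of_column {k : ℕ} {m e : (Fin ℓ × Fin n) →₀ ℕ}
    (hm : ∀ q : Fin ℓ × Fin n, (q.2 : ℕ) < k + 1 → m q = 0)
    (he : ∀ q : Fin ℓ × Fin n, (q.2 : ℕ) < k → e q = 0)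
    (hek : ∃ q : Fin ℓ × Fin n, (q.2 : ℕ) = k ∧ e q ≠ 0) : monLt m e := by
  obtain ⟨⟨i, j⟩, hj, hi⟩ := hek
  obtain ⟨i₀, hi₀, hmin⟩ : ∃ i₀, e (i₀, j) ≠ 0 ∧ ∀ i' < i₀, e (i', j) = 0 := by
    obtain ⟨i₀, h₀, hmin⟩ := WellFounded.has_min (wellFounded_lt (α := Fin ℓ))
      {i | e (i, j) ≠ 0} ⟨i, hi⟩
    exact ⟨i₀, h₀, fun i' hi' => by_contra fun h => hmin i' h hi'⟩
  refine ⟨(i₀, j), ?_, fun q hq => ?_⟩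
  · rw [hm _ (by simp only at hj ⊢; omega)]
    exact Nat.pos_of_ne_zero hi₀
  · rcases varIdx_lt_imp hq with hlt | ⟨heq, hlt⟩
    · simp only at hj hlt
      rw [hm q (by omega), he q (by omega)]
    · simp only at hj heq hlt
      obtain ⟨a, b⟩ := q
      obtain rfl : b = j := Fin.ext heq
      rw [hm _ (by simp only; omega), hmin a hlt]

/-- The exponent vector of the monomial whose columns from position `k` on are those of `A`. -/
def expFrom (n : ℕ) {ℓ : ℕ} : ℕ → List (Fin ℓ → ℕ) → (Fin ℓ × Fin n) →₀ ℕ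
  | _, [] => 0
  | k, V :: A => colExp n k V + expFrom n (k + 1) A

lemma expFrom_of_lt {k : ℕ} (A : List (Fin ℓ → ℕ)) {q : Fin ℓ × Fin n} (hq : (q.2 : ℕ) < k) :
    expFrom n k A q = 0 := by
  induction A generalizing k with
  | nil => rfl
  | cons V A ih =>
    rw [expFrom, Finsupp.add_apply, ih (by omega), colExp_apply, if_neg (by omega)]

lemma expFrom_of_le {k : ℕ} (A : List (Fin ℓ → ℕ)) {q : Fin ℓ × Fin n} (hq : k ≤ (q.2 : ℕ)) :
    expFrom n k A q = A.getD (q.2 - k) 0 q.1 := by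
  induction A generalizing k with
  | nil => rfl
  | cons V A ih =>
    rw [expFrom, Finsupp.add_apply, colExp_apply]
    split_ifs with h
    · rw [expFrom_of_lt A (by omega), h, Nat.sub_self]
      rfl
    · rw [ih (by omega), zero_add, show (q.2 : ℕ) - k = q.2 - (k + 1) + 1 by omega]
      rfl

lemma expFrom_zero (A : List (Fin ℓ → ℕ)) : expFrom n 0 A = expList A := by
  ext q
  rw [expFrom_of_le A (Nat.zero_le _), Nat.sub_zero]
  change _ = if h : (q.2 : ℕ) < A.length then A.get ⟨q.2, h⟩ q.1 else 0
  split_ifs with h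
  · rw [List.getD_eq_getElem _ _ h]
    rfl
  · rw [List.getD_eq_default _ _ (by omega)]
    rfl

lemma isLeading_removeEmpty_qiHead {m k : ℕ} (hk : k < n) (A : List (List (Fin ℓ → ℕ)))
    (e : (Fin ℓ × Fin n) →₀ ℕ) (he : ∀ q : Fin ℓ × Fin n, (q.2 : ℕ) < k → e q = 0)
    (h : IsLeading
      (removeEmpty n (k + 1) A fun C => qiSum n m (k + 1) (mergeBlocks C)) e)
    (b : List (Fin ℓ → ℕ)) (hb : ∀ t ∈ b, t ≠ 0) :
    IsLeading (removeEmpty n (k + 1) A fun C => qiHead n m k (mergeBlocks C) b)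
      (colExp n k b.sum + e) := by
  induction b with
  | nil => simpa [colExp_zero, qiHead] using h
  | cons t b ih =>
    rw [List.forall_mem_cons] at hb
    simp only [qiHead]
    rw [removeEmpty_add_mul, List.sum_cons, colExp_add, add_assoc]
    refine ((ih hb.2).monomial_mul _).add_of_forall_monLt fun m' hm' => ?_
    have hmem : removeEmpty n (k + 1) A
        (fun C => qiSum n m (k + 1) (mergeBlock t b (mergeBlocks C))) ∈ fromColumn ℓ n (k + 1) :=
      removeEmpty_mem (Subalgebra.toSubmodule (fromColumn ℓ n (k + 1))).toAddSubgroup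
        (P := fun _ => True) A (fun _ _ _ _ => trivial) _ _
        (fun j hj t p hp => (fromColumn ℓ n (k + 1)).mul_mem (colMon_mem_fromColumn hj t) hp)
        fun C _ => qiSum_mem_fromColumn _ _ _
    refine monLt_of_column (k := k) (fun q hq => apply_eq_zero_of_mem_fromColumn hmem hm' hq)
      (fun q hq => ?_) ?_
    · simp [colExp_apply, he q hq, hq.ne]
    · obtain ⟨i, hi⟩ := Function.ne_iff.1 hb.1
      refine ⟨(i, ⟨k, hk⟩), rfl, ?_⟩
      simp only [Finsupp.add_apply, colExp_apply, if_true]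
      have : t i ≠ 0 := hi
      omega

lemma isLeading_removeEmpty_qiSum (m k : ℕ) (hk : k + m = n) (A : List (List (Fin ℓ → ℕ)))
    (hA : ∀ b ∈ A, ∀ t ∈ b, t ≠ 0) (hlen : A.length ≤ m) :
    IsLeading (removeEmpty n k A fun C => qiSum n m k (mergeBlocks C))
      (expFrom n k (A.map List.sum)) := by
  induction A generalizing m k with
  | nil =>
    have h1 : (removeEmpty n k [] fun C : List (List (Fin ℓ → ℕ)) => qiSum n m k (mergeBlocks C)) =
        1 := by
      simp [removeEmpty, mergeBlocks, qiSum, monQI_nil]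
    rw [h1]
    refine ⟨by simp [expFrom], fun m' hm' hne => absurd ?_ hne⟩
    by_contra h
    rw [MvPolynomial.mem_support_iff, MvPolynomial.coeff_one, if_neg fun h0 => h h0.symm] at hm'
    exact hm' rfl
  | cons b A ih =>
    rw [List.forall_mem_cons] at hA
    obtain ⟨m, rfl⟩ : ∃ m', m = m' + 1 := ⟨m - 1, by simp at hlen; omega⟩
    have hlead := ih m (k + 1) (by omega) hA.2 (by simpa using hlen)
    rw [List.map_cons, expFrom]
    match b, hA.1 with
    | [], _ =>
      rw [removeEmpty, funext (dropColumn_qiSum m k), List.sum_nil, colExp_zero, zero_add]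
      exact hlead
    | t :: b, hb =>
      have h := isLeading_removeEmpty_qiHead (by omega) A _
        (fun q hq => expFrom_of_lt _ (by omega)) hlead (t :: b) hb
      simp only [qiHead] at h
      rw [removeEmpty]
      simpa only [mergeBlocks, qiSum_mergeBlock] using h

end LeadingMonomial

section MergedBlocks

variable {ℓ r : ℕ}

lemma mergeBlock_columns {P : (Fin ℓ → ℕ) → Prop} (hP : ∀ U V, P U → P V → P (U + V))
    (U : Fin ℓ → ℕ) (b : List (Fin ℓ → ℕ)) (L : List (List (Fin ℓ → ℕ))) (hU : P U)
    (hb : ∀ t ∈ b, P t) (hL : ∀ B ∈ L, ∀ V ∈ B, P V) :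
    ∀ B ∈ mergeBlock U b L, B ≠ [] ∧ ∀ V ∈ B, P V := by
  induction b generalizing U with
  | nil =>
    intro B hB
    obtain ⟨B, hBL, rfl⟩ := List.mem_map.1 hB
    exact ⟨by simp, List.forall_mem_cons.2 ⟨hU, hL B hBL⟩⟩
  | cons t b ih =>
    rw [List.forall_mem_cons] at hb
    intro B hB
    rcases List.mem_append.1 hB with hB | hB
    · obtain ⟨B, hBL, rfl⟩ := List.mem_map.1 hB
      exact ⟨by simp, List.forall_mem_cons.2 ⟨hU, (ih t hb.1 hb.2 B hBL).2⟩⟩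
    · exact ih _ (hP U t hU hb.1) hb.2 B hB

lemma mergeBlocks_columns {P : (Fin ℓ → ℕ) → Prop} (hP : ∀ U V, P U → P V → P (U + V))
    (C : List (List (Fin ℓ → ℕ))) (hC : ∀ b ∈ C, ∀ t ∈ b, P t) :
    ∀ B ∈ mergeBlocks C, ((∃ b ∈ C, b ≠ []) → B ≠ []) ∧ ∀ V ∈ B, P V := by
  induction C with
  | nil => simp [mergeBlocks]
  | cons b C ih =>
    rw [List.forall_mem_cons] at hC
    match b, hC.1 with
    | [], _ => simpa [mergeBlocks] using ih hC.2
    | t :: b, hb =>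
      rw [List.forall_mem_cons] at hb
      intro B hB
      have h := mergeBlock_columns hP t b _ hb.1 hb.2 (fun B hB => (ih hC.2 B hB).2) B hB
      exact ⟨fun _ => h.1, h.2⟩

lemma ExceedsBy.exists_ne_nil {d : ℕ} {C : List (List (Fin ℓ → ℕ))}
    (h : ExceedsBy d (C.map List.length)) : ∃ b ∈ C, b ≠ [] := by
  induction C generalizing d with
  | nil => exact h.elim
  | cons b C ih =>
    rcases h with h | h
    · refine ⟨b, List.mem_cons_self, ?_⟩
      rintro rfl
      simp at h
    · obtain ⟨b', hb', hne⟩ := ih h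
      exact ⟨b', List.mem_cons_of_mem _ hb', hne⟩

lemma qiSum_mergeBlocks_mem_Jdeal (n : ℕ) (C : List (List (Fin ℓ → ℕ)))
    (hC : ∀ b ∈ C, ∀ t ∈ b, (∑ i, t i) ≠ 0 ∧ r ∣ ∑ i, t i)
    (h : ExceedsBy 0 (C.map List.length)) :
    qiSum n n 0 (mergeBlocks C) ∈ Jdeal r n ℓ := by
  refine list_sum_mem fun p hp => ?_
  obtain ⟨B, hB, rfl⟩ := List.mem_map.1 hp
  have hcol := mergeBlocks_columns (P := fun t => (∑ i, t i) ≠ 0 ∧ r ∣ ∑ i, t i)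
    (fun U V hU hV => by
      simp only [Pi.add_apply, Finset.sum_add_distrib]
      exact ⟨by omega, dvd_add hU.2 hV.2⟩) C hC B hB
  rw [monQI_eq_Mlist]
  exact Mlist_mem_Jdeal n ⟨hcol.1 h.exists_ne_nil, hcol.2⟩

/-- An element of `J` with greatest monomial `X^A`, for a list `A` of columns satisfying the
trans condition. -/
lemma exists_isLeading_mem_Jdeal (hr : 1 ≤ r) (n : ℕ) (A : List (Fin ℓ → ℕ))
    (hA : ∀ V ∈ A, r ∣ ∑ i, V i) (ht : ExceedsBy 0 (A.map (colWeight r)))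
    (hlen : A.length ≤ n) : ∃ g ∈ Jdeal r n ℓ, IsLeading g (expList A) := by
  have hcol : ∀ b ∈ A.map (AV r), ∀ t ∈ b, (∑ i, t i) ≠ 0 ∧ r ∣ ∑ i, t i := by
    intro b hb t ht
    obtain ⟨V, -, rfl⟩ := List.mem_map.1 hb
    rw [sum_of_mem_AV r V t ht]
    exact ⟨by omega, dvd_rfl⟩
  refine ⟨removeEmpty n 0 (A.map (AV r)) fun C => qiSum n n 0 (mergeBlocks C),
    removeEmpty_mem_of_exceedsBy _ _ hcol 0 0 _ (qiSum_mergeBlocks_mem_Jdeal n) ?_, ?_⟩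
  · rw [List.map_map]
    exact (List.map_congr_left fun V _ => length_AV r V : A.map (List.length ∘ AV r) = _) ▸ ht
  · have h := isLeading_removeEmpty_qiSum n 0 (Nat.zero_add n) (A.map (AV r))
      (fun b hb t ht h0 => (hcol b hb t ht).1 (by simp [h0])) (by simpa using hlen)
    have hsum : (A.map (AV r)).map List.sum = A := by
      rw [List.map_map]
      exact (List.map_congr_left fun V hV => sum_AV r V (hA V hV)).trans (List.map_id A)
    rwa [hsum, expFrom_zero] at h

end MergedBlocks

/-- For every trans `r`-matrix `A` with `ℓ` rows and length `≤ n`, the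
polynomial `G_A` lies in the ideal `J`; consequently there is an element of `J` whose
lexicographically greatest monomial is `X^A`. -/
theorem statement7 (r n ℓ : ℕ) (hr : 1 ≤ r) (hn : 1 ≤ n) (hℓ : 1 ≤ ℓ)
    (A : List (Fin ℓ → ℕ)) (hA : IsRMatrixList r A) (ht : IsTransMat r A)
    (hlen : A.length ≤ n) :
    G r n A ∈ Jdeal r n ℓ ∧
      ∃ g ∈ Jdeal r n ℓ, g.coeff (expList A) ≠ 0 ∧
        ∀ m ∈ g.support, m ≠ expList A → monLt m (expList A) := by
  have h := ht.exceedsBy hr hA.1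
  exact ⟨Gaux_mem_Jdeal hr n _ A hA.1 h, exists_isLeading_mem_Jdeal hr n A hA.1 h hlen⟩


end
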